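/- arXiv:math/0510372 — 8 statements merged into one kernel-verified Lean document; each statement's English description precedes it below -/
import Mathlib

section
/- Let S be a finite semigroup with a zero element 0. Then the radical R(S) coincides with the union of all subminimal D-classes of S, where a D-class D is subminimal if for every D-class D' with D' ≤ D, either D' = {0} or D' contains no idempotents. -/
/-! Basic notions for nilpotent subsemigroups of a semigroup with zero,
following Ganyushkin–Mazorchuk, "On classification of maximal nilpotent
subsemigroups". -/

/-- The product `a * l₀ * l₁ * ⋯` of a nonempty list of semigroup elements
(the element `a` followed by the elements of the list `l`). -/
def prodl {S : Type*} [Mul S] (a : S) (l : List S) : S := l.foldl (· * ·) a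

/-- `T` is a subsemigroup of `S`, i.e. closed under multiplication. -/
def IsSubsgp {S : Type*} [Mul S] (T : Set S) : Prop :=
  ∀ ⦃a b : S⦄, a ∈ T → b ∈ T → a * b ∈ T

/-- Every product of `k` elements of `T` equals `0`. -/
def ProdZero {S : Type*} [Mul S] [Zero S] (T : Set S) (k : ℕ) : Prop :=
  ∀ (a : S) (l : List S), a ∈ T → (∀ x ∈ l, x ∈ T) → l.length + 1 = k →
    prodl a l = 0

/-- `T` is a nilpotent subsemigroup: it is closed under multiplication and some
positive power of it vanishes. -/
def IsNilpSubsgp {S : Type*} [Mul S] [Zero S] (T : Set S) : Prop :=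
  IsSubsgp T ∧ ∃ k : ℕ, 1 ≤ k ∧ ProdZero T k

/-- `k` is the nilpotency class of `T`: the least positive integer such that
every product of `k` elements of `T` equals `0`. -/
def NilpClass {S : Type*} [Mul S] [Zero S] (T : Set S) (k : ℕ) : Prop :=
  1 ≤ k ∧ ProdZero T k ∧ ∀ m : ℕ, 1 ≤ m → ProdZero T m → k ≤ m

/-- `T` is a maximal nilpotent subsemigroup of `S`: a maximal element of the
set of nilpotent subsemigroups of `S` ordered by inclusion. -/
def IsMaxNilpSubsgp {S : Type*} [Mul S] [Zero S] (T : Set S) : Prop :=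
  IsNilpSubsgp T ∧ ∀ T' : Set S, IsNilpSubsgp T' → T ⊆ T' → T' = T

/-- The principal left ideal `S¹a = {a} ∪ Sa`. -/
def lId {S : Type*} [Mul S] (a : S) : Set S := insert a {x | ∃ u, x = u * a}

/-- The principal right ideal `aS¹ = {a} ∪ aS`. -/
def rId {S : Type*} [Mul S] (a : S) : Set S := insert a {x | ∃ v, x = a * v}

/-- The principal two-sided ideal `(a) = S¹aS¹ = {a} ∪ Sa ∪ aS ∪ SaS`. -/
def pId {S : Type*} [Mul S] (a : S) : Set S :=
  insert a ({x | ∃ u, x = u * a} ∪ {x | ∃ v, x = a * v} ∪ {x | ∃ u v, x = u * a * v})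

/-- The radical `R(S)`: the set of `x ∈ S` such that the subsemigroup
`(x) = S¹xS¹` is nilpotent. -/
def radical (S : Type*) [Mul S] [Zero S] : Set S :=
  {x | ∃ k : ℕ, 1 ≤ k ∧ ProdZero (pId x) k}

/-- The J(=D for finite semigroups)-class of `a` is a minimal nonzero class:
`a ≠ 0` and every principal ideal contained in `(a)` is either `{0}` or equals
`(a)`. -/
def InMinClass {S : Type*} [Mul S] [Zero S] (a : S) : Prop :=
  a ≠ 0 ∧ ∀ b : S, pId b ⊆ pId a → b = 0 ∨ pId b = pId a

/-- A minimal idempotent: a nonzero idempotent lying in a minimal D-class. -/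
def MinIdem {S : Type*} [Mul S] [Zero S] (e : S) : Prop :=
  e * e = e ∧ InMinClass e

theorem prodl_append {S : Type*} [Mul S] (a : S) (l₁ l₂ : List S) :
    prodl a (l₁ ++ l₂) = prodl (prodl a l₁) l₂ :=
  List.foldl_append

theorem prodl_mul {S : Type*} [Semigroup S] (a b : S) (l : List S) :
    prodl (a * b) l = a * prodl b l := by
  induction l generalizing b with
  | nil => rfl
  | cons c l ih => exact (congrArg (prodl · l) (mul_assoc a b c)).trans (ih (b * c))

theorem prodl_zero {S : Type*} [SemigroupWithZero S] (l : List S) : prodl (0 : S) l = 0 := by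
  induction l with
  | nil => rfl
  | cons c l ih => exact (congrArg (prodl · l) (zero_mul c)).trans ih

theorem prodl_replicate_of_idempotent {S : Type*} [Mul S] {e : S} (he : e * e = e) (n : ℕ) :
    prodl e (List.replicate n e) = e := by
  induction n with
  | zero => rfl
  | succ n ih => exact (congrArg (prodl · (List.replicate n e)) he).trans ih

theorem IsSubsgp.prodl_mem {S : Type*} [Mul S] {T : Set S} (hT : IsSubsgp T) {a : S}
    {l : List S} (ha : a ∈ T) (hl : ∀ x ∈ l, x ∈ T) : prodl a l ∈ T := by
  induction l generalizing a with
  | nil => exact ha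
  | cons c l ih =>
    exact ih (hT ha (hl c List.mem_cons_self)) fun x hx => hl x (List.mem_cons_of_mem c hx)

/-- A nonempty subsemigroup of a finite semigroup contains an idempotent. -/
theorem IsSubsgp.exists_idempotent {S : Type*} [Semigroup S] [Finite S] {T : Set S}
    (hT : IsSubsgp T) (hne : T.Nonempty) : ∃ e ∈ T, e * e = e := by
  let _ : TopologicalSpace S := ⊥
  have : DiscreteTopology S := ⟨rfl⟩
  exact exists_idempotent_in_compact_subsemigroup (fun _ => continuous_of_discreteTopology) T hne
    T.toFinite.isCompact fun _ hx _ hy => hT hx hy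

/-- A subsemigroup of a finite semigroup whose only possible idempotent is `0` is nilpotent. -/
theorem IsSubsgp.prodZero_of_idempotent_eq_zero {S : Type*} [SemigroupWithZero S] [Finite S]
    {T : Set S} (hT : IsSubsgp T) (h : ∀ e ∈ T, e * e = e → e = 0) :
    ProdZero T (Nat.card S + 1) := by
  intro a l ha hl hlen
  obtain ⟨i, j, hij, heq⟩ : ∃ i j : Fin (l.length + 1), i < j ∧
      prodl a (l.take i) = prodl a (l.take j) := by
    have hninj : ¬ Function.Injective fun i : Fin (l.length + 1) => prodl a (l.take i) := by
      intro hinj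
      have := Nat.card_le_card_of_injective _ hinj
      rw [Nat.card_fin] at this
      omega
    simp only [Function.Injective, not_forall] at hninj
    obtain ⟨i, j, heq, hne⟩ := hninj
    rcases lt_or_gt_of_ne hne with hlt | hlt
    · exact ⟨i, j, hlt, heq⟩
    · exact ⟨j, i, hlt, heq.symm⟩
  set p := prodl a (l.take i) with hp
  obtain ⟨m, hm⟩ := List.take_prefix_take_left (l := l) (le_of_lt hij : (i : ℕ) ≤ j)
  have hp0 : p = 0 := by
    have hpm : prodl p m = p := by rw [hp, ← prodl_append, hm, ← heq]
    have hmem : ∀ x ∈ m, x ∈ T := fun x hx =>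
      hl x (List.mem_of_mem_take (hm ▸ List.mem_append_right _ hx))
    cases m with
    | nil =>
      have := congrArg List.length hm
      simp only [List.append_nil, List.length_take] at this
      omega
    | cons b m =>
      have hfix : p * prodl b m = p := (prodl_mul p b m).symm.trans hpm
      have hstab : IsSubsgp {s | s ∈ T ∧ p * s = p} := fun s t hs ht =>
        ⟨hT hs.1 ht.1, by rw [← mul_assoc, hs.2, ht.2]⟩
      obtain ⟨e, ⟨heT, hpe⟩, he⟩ := hstab.exists_idempotent
        ⟨prodl b m, hT.prodl_mem (hmem b List.mem_cons_self)
          fun x hx => hmem x (List.mem_cons_of_mem b hx), hfix⟩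
      rw [← hpe, h e heT he, mul_zero]
  rw [← List.take_append_drop i l, prodl_append, ← hp, hp0, prodl_zero]

theorem mem_pId_self {S : Type*} [Mul S] (a : S) : a ∈ pId a := Set.mem_insert _ _

theorem mul_mem_pId_left {S : Type*} [Semigroup S] {a x : S} (u : S) (hx : x ∈ pId a) :
    u * x ∈ pId a := by
  rcases hx with rfl | (⟨v, rfl⟩ | ⟨v, rfl⟩) | ⟨v, w, rfl⟩
  · exact .inr (.inl (.inl ⟨u, rfl⟩))
  · exact .inr (.inl (.inl ⟨u * v, (mul_assoc _ _ _).symm⟩))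
  · exact .inr (.inr ⟨u, v, (mul_assoc _ _ _).symm⟩)
  · exact .inr (.inr ⟨u * v, w, by simp only [mul_assoc]⟩)

theorem mul_mem_pId_right {S : Type*} [Semigroup S] {a x : S} (u : S) (hx : x ∈ pId a) :
    x * u ∈ pId a := by
  rcases hx with rfl | (⟨v, rfl⟩ | ⟨v, rfl⟩) | ⟨v, w, rfl⟩
  · exact .inr (.inl (.inr ⟨u, rfl⟩))
  · exact .inr (.inr ⟨v, u, rfl⟩)
  · exact .inr (.inl (.inr ⟨v * u, mul_assoc _ _ _⟩))
  · exact .inr (.inr ⟨v, w * u, by simp only [mul_assoc]⟩)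

theorem isSubsgp_pId {S : Type*} [Semigroup S] (a : S) : IsSubsgp (pId a) :=
  fun _ b hx _ => mul_mem_pId_right b hx

theorem pId_subset_of_mem {S : Type*} [Semigroup S] {a b : S} (hb : b ∈ pId a) :
    pId b ⊆ pId a := by
  rintro x (rfl | (⟨v, rfl⟩ | ⟨v, rfl⟩) | ⟨v, w, rfl⟩)
  · exact hb
  · exact mul_mem_pId_left v hb
  · exact mul_mem_pId_right v hb
  · exact mul_mem_pId_right w (mul_mem_pId_left v hb)

/-- For a finite semigroup `S` with zero, the radical `R(S)`
coincides with the union of all subminimal D-classes: the set of `a ∈ S` such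
that every `b` with `(b) ⊆ (a)` satisfies `b = 0` or `b` is not an idempotent
(i.e. every D-class `D' ≤ D_a` is `{0}` or contains no idempotents). -/
theorem statement4 {S : Type*} [SemigroupWithZero S] [Finite S] :
    radical S = {a : S | ∀ b : S, pId b ⊆ pId a → b = 0 ∨ b * b ≠ b} := by
  ext a
  constructor
  · rintro ⟨k, hk, hzero⟩ b hb
    by_cases he : b * b = b
    · have hba := hb (mem_pId_self b)
      refine .inl ?_
      rw [← prodl_replicate_of_idempotent he (k - 1)]
      refine hzero b _ hba (fun x hx => ?_) (by rw [List.length_replicate]; omega)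
      rwa [List.eq_of_mem_replicate hx]
    · exact .inr he
  · intro h
    refine ⟨Nat.card S + 1, by omega, (isSubsgp_pId a).prodZero_of_idempotent_eq_zero ?_⟩
    intro e he hee
    exact (h e (pId_subset_of_mem he)).resolve_right fun hne => hne hee
end

section
/- Let S be a finite semigroup with a zero element 0. Then the radical R(S) = {x ∈ S : the subsemigroup (x) = S¹xS¹ is nilpotent} is itself a nilpotent subsemigroup of S, i.e., there exists k ≥ 1 such that every product of k elements of R(S) equals 0. -/
theorem mul_right_mem_rId {S : Type*} [Semigroup S] {a x : S} (hx : x ∈ rId a) (v : S) :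
    x * v ∈ rId a := by
  rcases hx with rfl | ⟨w, rfl⟩
  · exact Or.inr ⟨v, rfl⟩
  · exact Or.inr ⟨w * v, mul_assoc _ _ _⟩

theorem rId_subset {S : Type*} [Semigroup S] {a b : S} (h : b ∈ rId a) : rId b ⊆ rId a := by
  rintro x (rfl | ⟨v, rfl⟩)
  · exact h
  · exact mul_right_mem_rId h v

theorem pId_mul_right_subset {S : Type*} [Semigroup S] (a b : S) : pId (a * b) ⊆ pId a := by
  rintro x (rfl | (⟨u, rfl⟩ | ⟨v, rfl⟩) | ⟨u, v, rfl⟩)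
  · exact Or.inr (Or.inl (Or.inr ⟨b, rfl⟩))
  · exact Or.inr (Or.inr ⟨u, b, (mul_assoc _ _ _).symm⟩)
  · exact Or.inr (Or.inl (Or.inr ⟨b * v, mul_assoc _ _ _⟩))
  · exact Or.inr (Or.inr ⟨u, b * v, by simp only [mul_assoc]⟩)

theorem mul_right_mem_radical {S : Type*} [SemigroupWithZero S] {a : S} (ha : a ∈ radical S)
    (b : S) : a * b ∈ radical S := by
  obtain ⟨k, hk, h⟩ := ha
  exact ⟨k, hk, fun c l hc hl => h c l (pId_mul_right_subset a b hc)
    fun x hx => pId_mul_right_subset a b (hl x hx)⟩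

/-- An element fixed by right multiplication by an element of the radical vanishes. -/
theorem eq_zero_of_eq_mul_radical {S : Type*} [SemigroupWithZero S] {p u : S}
    (hu : u ∈ radical S) (hp : p = p * u) : p = 0 := by
  obtain ⟨k, hk, h⟩ := hu
  have hfix (n : ℕ) : prodl p (List.replicate n u) = p := by
    induction n with
    | zero => rfl
    | succ n ih =>
      change prodl (p * u) (List.replicate n u) = p
      rwa [← hp]
  have hself : u ∈ pId u := Or.inl rfl
  have hzero := h u (List.replicate (k - 1) u) hself
    (fun x hx => List.eq_of_mem_replicate hx ▸ hself) (by simp; omega)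
  rw [← hfix (k - 1), hp, prodl_mul, hzero, mul_zero]

/-- Right multiplication by an element of the radical strictly shrinks the principal right
ideal of a nonzero element. -/
theorem rId_mul_radical_ssubset {S : Type*} [SemigroupWithZero S] {p r : S}
    (hp : p ≠ 0) (hr : r ∈ radical S) : rId (p * r) ⊂ rId p := by
  refine Set.ssubset_iff_subset_ne.2 ⟨rId_subset (Or.inr ⟨r, rfl⟩), fun heq => hp ?_⟩
  have hmem : p ∈ rId (p * r) := heq ▸ Or.inl rfl
  rcases hmem with h | ⟨v, h⟩
  · exact eq_zero_of_eq_mul_radical hr h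
  · exact eq_zero_of_eq_mul_radical (mul_right_mem_radical hr v) (h.trans (mul_assoc _ _ _))

theorem prodl_eq_zero_or_length_lt {S : Type*} [SemigroupWithZero S] [Finite S] (l : List S)
    (hl : ∀ x ∈ l, x ∈ radical S) (p : S) : prodl p l = 0 ∨ l.length < (rId p).ncard := by
  induction l generalizing p with
  | nil => exact Or.inr ((Set.ncard_pos).2 ⟨p, Or.inl rfl⟩)
  | cons r l ih =>
    by_cases hp : p = 0
    · exact Or.inl (by rw [hp, prodl_zero])
    · refine (ih (fun x hx => hl x (List.mem_cons_of_mem _ hx)) (p * r)).imp id fun h => ?_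
      have := Set.ncard_lt_ncard (rId_mul_radical_ssubset hp (hl r List.mem_cons_self))
      rw [List.length_cons]
      omega

/-- For a finite semigroup `S` with zero, the radical `R(S)`
is itself a nilpotent subsemigroup of `S`: it is closed under multiplication
and there exists `k ≥ 1` such that every product of `k` elements of `R(S)`
equals `0`. -/
theorem statement5 {S : Type*} [SemigroupWithZero S] [Finite S] :
    IsSubsgp (radical S) ∧ ∃ k : ℕ, 1 ≤ k ∧ ProdZero (radical S) k := by
  refine ⟨fun a b ha _ => mul_right_mem_radical ha b, Nat.card S + 1, by omega,
    fun a l _ hl hlen => (prodl_eq_zero_or_length_lt l hl a).resolve_right fun h => ?_⟩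
  have := Set.ncard_le_card (rId a)
  omega
end

section
/- Let S be a finite semigroup with a zero element 0 such that R(S) = {0}, and let e, f be distinct minimal idempotents of S. Then e and f are orthogonal (ef = fe = 0) if and only if they commute (ef = fe). -/
/-- In a finite semigroup, if `e = u * g * v` and `g` lies in `e * S`, then `e * S = g * S`. -/
theorem range_mul_left_eq {S : Type*} [Semigroup S] [Finite S] {e g u v : S}
    (hg : e * g = g) (h : e = u * g * v) :
    Set.range (g * ·) = Set.range (e * ·) := by
  refine Set.eq_of_subset_of_ncard_le ?_ ?_ (Set.toFinite _)
  · rintro _ ⟨s, rfl⟩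
    exact ⟨g * s, by simp only [← mul_assoc, hg]⟩
  · have hsub : Set.range (e * ·) ⊆ (u * ·) '' Set.range (g * ·) := by
      rintro _ ⟨s, rfl⟩
      refine ⟨g * (v * s), ⟨v * s, rfl⟩, ?_⟩
      dsimp only
      rw [h]
      simp only [mul_assoc]
    exact (Set.ncard_le_ncard hsub (Set.toFinite _)).trans (Set.ncard_image_le (Set.toFinite _))

/-- In a finite semigroup, an idempotent `g ≤ e` generating the same principal ideal as the
idempotent `e` equals `e`. -/
theorem eq_of_mem_pId {S : Type*} [Semigroup S] [Finite S] {e g : S}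
    (he : e * e = e) (hg : g * g = g) (heg : e * g = g) (hge : g * e = g) (h : e ∈ pId g) :
    g = e := by
  have key : ∀ u v : S, e = u * g * v → g = e := by
    intro u v huv
    obtain ⟨s, hs⟩ : e ∈ Set.range (g * ·) := range_mul_left_eq heg huv ▸ ⟨e, he⟩
    dsimp only at hs
    rw [← hge, ← hs, ← mul_assoc, hg]
  rcases h with h | ((⟨u, h⟩ | ⟨v, h⟩) | ⟨u, v, h⟩)
  · exact h.symm
  · exact key u g (by rw [mul_assoc, hg, h])
  · exact key g v (by rw [hg, h])
  · exact key u v h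

theorem MinIdem.mul_eq_left_of_commute {S : Type*} [SemigroupWithZero S] [Finite S] {e f : S}
    (he : MinIdem e) (hf : f * f = f) (h : e * f = f * e) (h0 : e * f ≠ 0) :
    e * f = e := by
  have heg : e * (e * f) = e * f := by rw [← mul_assoc, he.1]
  have hge : e * f * e = e * f := by rw [mul_assoc, ← h, heg]
  have hgf : e * f * f = e * f := by rw [mul_assoc, hf]
  refine eq_of_mem_pId he.1 ?_ heg hge ?_
  · rw [← mul_assoc, hge, hgf]
  · rw [(he.2.2 _ (pId_mul_right_subset e f)).resolve_left h0]
    exact mem_pId_self e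

/-- Let `S` be a finite semigroup with zero with
`R(S) = {0}` and let `e, f` be distinct minimal idempotents. Then `e` and `f`
are orthogonal (`ef = fe = 0`) if and only if they commute (`ef = fe`). -/
theorem statement10 {S : Type*} [SemigroupWithZero S] [Finite S]
    (hrad : radical S = {0}) (e f : S) (he : MinIdem e) (hf : MinIdem f)
    (hne : e ≠ f) :
    (e * f = 0 ∧ f * e = 0) ↔ e * f = f * e := by
  refine ⟨fun h => h.1.trans h.2.symm, fun h => ?_⟩
  by_cases h0 : e * f = 0
  · exact ⟨h0, h ▸ h0⟩
  · refine absurd ?_ hne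
    rw [← he.mul_eq_left_of_commute hf.1 h h0, h]
    exact hf.mul_eq_left_of_commute he.1 h.symm (h ▸ h0)
end

section
/- Let S be a finite semigroup with a zero element 0 such that R(S) = {0}, let e be a minimal idempotent of S, and let f be a nonzero idempotent with f ⪯ e (i.e., ef = fe = f). Then f lies in the same D-class as e, i.e., (f) = (e); in particular f is a minimal idempotent. -/
theorem pId_subset_of_eq_mul {S : Type*} [Semigroup S] {e f : S} (h : e * f = f) :
    pId f ⊆ pId e := by
  rintro x (rfl | (⟨u, rfl⟩ | ⟨v, rfl⟩) | ⟨u, v, rfl⟩)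
  · exact Or.inr (Or.inl (Or.inr ⟨x, h.symm⟩))
  · exact Or.inr (Or.inr ⟨u, f, by rw [mul_assoc, h]⟩)
  · exact Or.inr (Or.inl (Or.inr ⟨f * v, by rw [← mul_assoc, h]⟩))
  · exact Or.inr (Or.inr ⟨u, f * v, by rw [mul_assoc u e, ← mul_assoc e, h, mul_assoc]⟩)

/-- Let `S` be a finite semigroup with zero with
`R(S) = {0}`, let `e` be a minimal idempotent and let `f` be a nonzero
idempotent with `f ⪯ e` (i.e. `ef = fe = f`). Then `f` lies in the same
D-class as `e`, i.e. `(f) = (e)`; in particular `f` is a minimal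
idempotent. -/
theorem statement11 {S : Type*} [SemigroupWithZero S] [Finite S]
    (hrad : radical S = {0}) (e : S) (he : MinIdem e)
    (f : S) (hf0 : f ≠ 0) (hff : f * f = f) (h1 : e * f = f) (h2 : f * e = f) :
    pId f = pId e ∧ MinIdem f := by
  have hsub := pId_subset_of_eq_mul h1
  have heq : pId f = pId e := (he.2.2 f hsub).resolve_left hf0
  exact ⟨heq, hff, hf0, fun b hb => heq ▸ he.2.2 b (heq ▸ hb)⟩
end

section
/- Let S be a finite semigroup with a zero element 0 and let x ∈ S be such that x does not belong to the radical R(S). Then there exist idempotents e, f ∈ S such that exf ≠ 0. -/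
/-- A nonempty multiplicatively closed subset of a finite semigroup contains an idempotent. -/
theorem exists_idempotent_mem_of_finite {S : Type*} [Semigroup S] [Finite S] (A : Set S)
    (hne : A.Nonempty) (hmul : ∀ a ∈ A, ∀ b ∈ A, a * b ∈ A) : ∃ e ∈ A, e * e = e := by
  let : TopologicalSpace S := ⊥
  have : DiscreteTopology S := ⟨rfl⟩
  exact exists_idempotent_in_compact_subsemigroup (fun _ => continuous_of_discreteTopology)
    A hne A.toFinite.isCompact hmul

theorem mul_prodl {S : Type*} [Semigroup S] (p a : S) (l : List S) :
    prodl (p * a) l = p * prodl a l := by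
  induction l generalizing a with
  | nil => rfl
  | cons b l ih => simpa [prodl, mul_assoc] using ih (a * b)

theorem mul_mem_pId {S : Type*} [Semigroup S] {x a : S} (ha : a ∈ pId x) (s : S) :
    a * s ∈ pId x := by
  rcases ha with rfl | (⟨u, rfl⟩ | ⟨v, rfl⟩) | ⟨u, v, rfl⟩
  · exact .inr (.inl (.inr ⟨s, rfl⟩))
  · exact .inr (.inr ⟨u, s, rfl⟩)
  · exact .inr (.inl (.inr ⟨v * s, mul_assoc _ _ _⟩))
  · exact .inr (.inr ⟨u, v * s, mul_assoc _ _ _⟩)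

theorem prodl_mem_pId {S : Type*} [Semigroup S] {x a : S} (ha : a ∈ pId x) (l : List S) :
    prodl a l ∈ pId x := by
  induction l generalizing a with
  | nil => exact ha
  | cons b l ih => exact ih (mul_mem_pId ha b)

/-- In a finite semigroup, the principal ideal of an element outside the radical contains a
nonzero idempotent. -/
theorem exists_idempotent_mem_pId {S : Type*} [SemigroupWithZero S] [Finite S] {x : S}
    (hx : x ∉ radical S) : ∃ g ∈ pId x, g * g = g ∧ g ≠ 0 := by
  have hk : ¬ ProdZero (pId x) (Nat.card S + 1) := fun h => hx ⟨_, Nat.le_add_left _ _, h⟩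
  simp only [ProdZero, not_forall] at hk
  obtain ⟨a, l, -, hl, hlen, hne⟩ := hk
  obtain ⟨i, j, hij, heq⟩ : ∃ i j : Fin (Nat.card S + 1), i < j ∧
      prodl a (l.take i) = prodl a (l.take j) := by
    have hinj : ¬ Function.Injective fun i : Fin (Nat.card S + 1) => prodl a (l.take i) := by
      intro h
      have := Nat.card_le_card_of_injective _ h
      simp at this
    simp only [Function.Injective, not_forall] at hinj
    obtain ⟨i, j, h, hij⟩ := hinj
    rcases lt_or_gt_of_ne hij with h' | h'
    · exact ⟨i, j, h', h⟩
    · exact ⟨j, i, h', h.symm⟩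
  set p := prodl a (l.take i) with hp
  have hp0 : p ≠ 0 := by
    intro h0
    apply hne
    rw [← List.take_append_drop i l, prodl_append, ← hp, h0, prodl_zero]
  obtain ⟨w, hw, hpw⟩ : ∃ w ∈ pId x, p * w = p := by
    have hsplit : l.take j = l.take i ++ (l.take j).drop i := by
      conv_lhs => rw [← List.take_append_drop i (l.take j)]
      rw [List.take_take, min_eq_left (Fin.le_def.1 hij.le)]
    have hmem : ∀ b ∈ (l.take j).drop i, b ∈ pId x := fun b hb =>
      hl b (List.mem_of_mem_take (List.mem_of_mem_drop hb))
    have hlen' : ((l.take j).drop i).length = j - i := by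
      have := j.isLt
      simp only [List.length_drop, List.length_take]
      omega
    rw [hsplit, prodl_append, ← hp] at heq
    have hlt := Fin.lt_def.1 hij
    cases hm : (l.take j).drop i with
    | nil => rw [hm, List.length_nil] at hlen'; omega
    | cons b m =>
      rw [hm] at heq hmem
      refine ⟨prodl b m, prodl_mem_pId (hmem b List.mem_cons_self) m, ?_⟩
      rw [← mul_prodl]
      exact heq.symm
  obtain ⟨g, ⟨hg, hpg⟩, hgg⟩ := exists_idempotent_mem_of_finite {s | s ∈ pId x ∧ p * s = p}
    ⟨w, hw, hpw⟩ fun s hs t ht => ⟨mul_mem_pId hs.1 t, by rw [← mul_assoc, hs.2, ht.2]⟩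
  exact ⟨g, hg, hgg, fun h0 => hp0 (by rw [← hpg, h0, mul_zero])⟩

/-- An idempotent `g` of the principal ideal of `x` factors as `u * x * v` with `u ∈ gS` and
`v ∈ Sg`. -/
theorem exists_eq_mul_mul_of_mem_pId {S : Type*} [Semigroup S] {x g : S} (hg : g ∈ pId x)
    (hgg : g * g = g) : ∃ u v, u * x * v = g ∧ g * u = u ∧ v * g = v := by
  obtain ⟨u, v, h⟩ : ∃ u v, u * x * v = g := by
    rcases hg with h | (⟨u, h⟩ | ⟨v, h⟩) | ⟨u, v, h⟩
    · exact ⟨g, g, by rw [← h, hgg, hgg]⟩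
    · exact ⟨u, g, by rw [← h, hgg]⟩
    · exact ⟨g, v, by rw [mul_assoc, ← h, hgg]⟩
    · exact ⟨u, v, h.symm⟩
  refine ⟨g * u, v * g, ?_, by rw [← mul_assoc, hgg], by rw [mul_assoc, hgg]⟩
  calc g * u * x * (v * g) = g * (u * x * v) * g := by simp only [mul_assoc]
    _ = g := by rw [h, hgg, hgg]

/-- Let `S` be a finite semigroup with zero and let `x ∈ S`
not belong to the radical `R(S)`. Then there exist idempotents `e, f ∈ S`
such that `e * x * f ≠ 0`. -/
theorem statement14 {S : Type*} [SemigroupWithZero S] [Finite S]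
    (x : S) (hx : x ∉ radical S) :
    ∃ e f : S, e * e = e ∧ f * f = f ∧ e * x * f ≠ 0 := by
  obtain ⟨g, hg, hgg, hg0⟩ := exists_idempotent_mem_pId hx
  obtain ⟨u, v, huv, hu, hv⟩ := exists_eq_mul_mul_of_mem_pId hg hgg
  obtain ⟨e, he, hee⟩ := exists_idempotent_mem_of_finite {s | u * s = u}
    ⟨x * v * u, by simpa only [Set.mem_ofPred_eq, ← mul_assoc, huv] using hu⟩
    fun s (hs : u * s = u) t (ht : u * t = u) => show u * (s * t) = u by rw [← mul_assoc, hs, ht]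
  obtain ⟨f, hf, hff⟩ := exists_idempotent_mem_of_finite {s | s * v = v}
    ⟨v * (u * x), by rw [Set.mem_ofPred_eq, mul_assoc, huv, hv]⟩
    fun s (hs : s * v = v) t (ht : t * v = v) => show s * t * v = v by rw [mul_assoc, ht, hs]
  refine ⟨e, f, hee, hff, fun h0 => hg0 ?_⟩
  calc g = u * e * x * (f * v) := by rw [he, hf, huv]
    _ = u * (e * x * f) * v := by simp only [mul_assoc]
    _ = 0 := by rw [h0, mul_zero, zero_mul]
end

section
/- Let S be a finite semigroup with a zero element 0 such that R(S) = {0}, and let M be a non-empty set of minimal idempotents of S satisfying conditions (I)-(III). For every strict partial order ρ on M, the set Mon(ρ) = {x ∈ S : for all e, f ∈ M, exf ≠ 0 implies (e, f) ∈ ρ} is a subsemigroup of S which is nilpotent of nilpotency class at most |M|; moreover ρ₁ ⊆ ρ₂ implies Mon(ρ₁) ⊆ Mon(ρ₂). -/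
/-- Condition (I): the elements of `M` commute pairwise. -/
def CondI {S : Type*} [Mul S] (M : Set S) : Prop :=
  ∀ e ∈ M, ∀ f ∈ M, e * f = f * e

/-- Condition (II): for every nonzero `x ∈ S` there are `e, f ∈ M` with
`e * x * f ≠ 0`. -/
def CondII {S : Type*} [Mul S] [Zero S] (M : Set S) : Prop :=
  ∀ x : S, x ≠ 0 → ∃ e ∈ M, ∃ f ∈ M, e * x * f ≠ 0

/-- Condition (III): for all `x, y ∈ S` and `e, f ∈ M` one has
`{exgyf : g ∈ M} ⊆ {0, exyf}`, and if `exyf ≠ 0` then `exgyf ≠ 0` for some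
`g ∈ M`. -/
def CondIII {S : Type*} [Mul S] [Zero S] (M : Set S) : Prop :=
  ∀ x y : S, ∀ e ∈ M, ∀ f ∈ M,
    (∀ g ∈ M, e * x * g * y * f = 0 ∨ e * x * g * y * f = e * x * y * f) ∧
    (e * x * y * f ≠ 0 → ∃ g ∈ M, e * x * g * y * f ≠ 0)

/-- `ρ` is a strict partial order on the set `M`. -/
def IsStrictOrderOn {S : Type*} (M : Set S) (ρ : S → S → Prop) : Prop :=
  (∀ e ∈ M, ¬ ρ e e) ∧
  (∀ e ∈ M, ∀ f ∈ M, ∀ g ∈ M, ρ e f → ρ f g → ρ e g)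

/-- `Mon M ρ = {x ∈ S : for all e, f ∈ M, e * x * f ≠ 0 implies ρ e f}`. -/
def Mon {S : Type*} [Mul S] [Zero S] (M : Set S) (ρ : S → S → Prop) : Set S :=
  {x : S | ∀ e ∈ M, ∀ f ∈ M, e * x * f ≠ 0 → ρ e f}

/-- The relation `ρ_T` associated to a subset `T ⊆ S`:
`ρ_T e f ↔ e * x * f ≠ 0 for some x ∈ T`. -/
def rhoRel {S : Type*} [Mul S] [Zero S] (T : Set S) (e f : S) : Prop :=
  ∃ x ∈ T, e * x * f ≠ 0

theorem CondIII.exists_mul_ne_zero {S : Type*} [SemigroupWithZero S] {M : Set S}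
    (h3 : CondIII M) {x y e f : S} (he : e ∈ M) (hf : f ∈ M) (h : e * (x * y) * f ≠ 0) :
    ∃ g ∈ M, e * x * g ≠ 0 ∧ g * y * f ≠ 0 := by
  rw [← mul_assoc e x y] at h
  obtain ⟨g, hg, hne⟩ := (h3 x y e he f hf).2 h
  refine ⟨g, hg, fun h0 => hne ?_, fun h0 => hne ?_⟩
  · rw [h0, zero_mul, zero_mul]
  · rw [mul_assoc (e * x) g y, mul_assoc (e * x), h0, mul_zero]

theorem isSubsgp_mon {S : Type*} [SemigroupWithZero S] {M : Set S} (h3 : CondIII M)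
    {ρ : S → S → Prop} (hρ : IsStrictOrderOn M ρ) : IsSubsgp (Mon M ρ) := by
  intro a b ha hb e he f hf h
  obtain ⟨g, hg, h₁, h₂⟩ := h3.exists_mul_ne_zero he hf h
  exact hρ.2 e he g hg f hf (ha e he g hg h₁) (hb g hg f hf h₂)

/-- If `e * (a * l₀ * ⋯) * f ≠ 0` with all factors in `Mon M ρ`, then at least as many elements
of `M` lie strictly below `f` as there are factors. -/
theorem exists_finset_below_of_prodl_ne_zero {S : Type*} [SemigroupWithZero S] {M : Set S}
    (h3 : CondIII M) {ρ : S → S → Prop} (hρ : IsStrictOrderOn M ρ) {a e : S}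
    (ha : a ∈ Mon M ρ) (he : e ∈ M) (l : List S) (hl : ∀ x ∈ l, x ∈ Mon M ρ) :
    ∀ f ∈ M, e * prodl a l * f ≠ 0 →
      ∃ C : Finset S, (C : Set S) ⊆ M ∧ C.card = l.length + 1 ∧ ∀ c ∈ C, ρ c f := by
  classical
  induction l using List.reverseRecOn with
  | nil =>
    intro f hf h
    exact ⟨{e}, by simpa using he, by simp, by simpa using ha e he f hf h⟩
  | append_singleton l b ih =>
    intro f hf h
    have hprod : prodl a (l ++ [b]) = prodl a l * b := by simp [prodl]
    rw [hprod] at h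
    obtain ⟨g, hg, h₁, h₂⟩ := h3.exists_mul_ne_zero he hf h
    obtain ⟨C, hCM, hcard, hC⟩ := ih (fun x hx => hl x (by simp [hx])) g hg h₁
    have hgf : ρ g f := hl b (by simp) g hg f hf h₂
    have hgC : g ∉ C := fun hmem => hρ.1 g hg (hC g hmem)
    refine ⟨insert g C, ?_, ?_, ?_⟩
    · rw [Finset.coe_insert]
      exact Set.insert_subset hg hCM
    · simp [Finset.card_insert_of_notMem hgC, hcard]
    · intro c hc
      rcases Finset.mem_insert.1 hc with rfl | hc
      · exact hgf
      · exact hρ.2 c (hCM hc) g hg f hf (hC c hc) hgf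

theorem prodZero_mon_ncard {S : Type*} [SemigroupWithZero S] [Finite S] {M : Set S}
    (h2 : CondII M) (h3 : CondIII M) {ρ : S → S → Prop} (hρ : IsStrictOrderOn M ρ) :
    ProdZero (Mon M ρ) M.ncard := by
  classical
  intro a l ha hl hlen
  by_contra hne
  obtain ⟨e, he, f, hf, h⟩ := h2 _ hne
  obtain ⟨C, hCM, hcard, hC⟩ := exists_finset_below_of_prodl_ne_zero h3 hρ ha he l hl f hf h
  have hfC : f ∉ C := fun hmem => hρ.1 f hf (hC f hmem)
  have hsub : ((insert f C : Finset S) : Set S) ⊆ M := by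
    rw [Finset.coe_insert]
    exact Set.insert_subset hf hCM
  have hle := Set.ncard_le_ncard hsub (Set.toFinite M)
  rw [Set.ncard_coe_finset, Finset.card_insert_of_notMem hfC] at hle
  omega

theorem ProdZero.exists_nilpClass_le {S : Type*} [Mul S] [Zero S] {T : Set S} {k : ℕ}
    (hk : 1 ≤ k) (h : ProdZero T k) : ∃ c, NilpClass T c ∧ c ≤ k := by
  classical
  have hex : ∃ n, 1 ≤ n ∧ ProdZero T n := ⟨k, hk, h⟩
  exact ⟨Nat.find hex, ⟨(Nat.find_spec hex).1, (Nat.find_spec hex).2,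
    fun m hm hz => Nat.find_min' hex ⟨hm, hz⟩⟩, Nat.find_min' hex ⟨hk, h⟩⟩

/-- Let `S` be a finite semigroup with zero with
`R(S) = {0}` and `M` a nonempty set of minimal idempotents satisfying
(I)–(III). For every strict partial order `ρ` on `M`, the set `Mon M ρ` is a
subsemigroup of `S` which is nilpotent of nilpotency class at most `|M|`;
moreover `ρ₁ ⊆ ρ₂` implies `Mon M ρ₁ ⊆ Mon M ρ₂`. -/
theorem statement16 {S : Type*} [SemigroupWithZero S] [Finite S]
    (hrad : radical S = {0}) (M : Set S) (hMne : M.Nonempty)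
    (hMmin : ∀ e ∈ M, MinIdem e)
    (h1 : CondI M) (h2 : CondII M) (h3 : CondIII M) :
    (∀ ρ : S → S → Prop, IsStrictOrderOn M ρ →
      IsSubsgp (Mon M ρ) ∧ ∃ c : ℕ, NilpClass (Mon M ρ) c ∧ c ≤ M.ncard) ∧
    (∀ ρ₁ ρ₂ : S → S → Prop, IsStrictOrderOn M ρ₁ → IsStrictOrderOn M ρ₂ →
      (∀ e ∈ M, ∀ f ∈ M, ρ₁ e f → ρ₂ e f) → Mon M ρ₁ ⊆ Mon M ρ₂) := by
  refine ⟨fun ρ hρ => ⟨isSubsgp_mon h3 hρ, ?_⟩, ?_⟩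
  · exact (prodZero_mon_ncard h2 h3 hρ).exists_nilpClass_le
      ((Set.ncard_pos (Set.toFinite M)).2 hMne)
  · intro ρ₁ ρ₂ _ _ hle x hx e he f hf h
    exact hle e he f hf (hx e he f hf h)
end

section
/- Let S be a finite semigroup with a zero element 0 such that R(S) = {0}, and let M be a non-empty set of minimal idempotents of S satisfying conditions (I)-(III). For every nilpotent subsemigroup T of S, the relation ρ_T = {(e, f) ∈ M × M : exf ≠ 0 for some x ∈ T} is a strict partial order on M: it is transitive, and there is no pair e, f ∈ M with both (e, f) ∈ ρ_T and (f, e) ∈ ρ_T (in particular (e, e) ∉ ρ_T for all e ∈ M). Moreover T₁ ⊆ T₂ implies ρ_{T₁} ⊆ ρ_{T₂}. -/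
/-- In a finite semigroup, if `f = w * f * v`, then `f` is recurrent under left
multiplication by `w`. -/
theorem exists_iterate_mul_left_eq_self {S : Type*} [Semigroup S] [Finite S] {f w v : S}
    (h : f = w * f * v) : ∃ n : ℕ, (w * ·)^[n + 1] f = f := by
  have hcomm : Function.Commute (w * · : S → S) (· * v) := fun x => (mul_assoc w x v).symm
  have hfix (n : ℕ) : (w * ·)^[n] ((· * v)^[n] f) = f := by
    refine (congrFun (hcomm.comp_iterate n) f).symm.trans (Function.iterate_fixed ?_ n)
    simpa [mul_assoc] using h.symm
  obtain ⟨i, j, hij, heq⟩ : ∃ i j : ℕ, i < j ∧ (w * · : S → S)^[i] = (w * ·)^[j] := by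
    obtain ⟨i, j, hne, heq⟩ :=
      Finite.exists_ne_map_eq_of_infinite fun n : ℕ => (w * · : S → S)^[n]
    rcases hne.lt_or_gt with hlt | hlt
    exacts [⟨i, j, hlt, heq⟩, ⟨j, i, hlt, heq.symm⟩]
  obtain ⟨d, rfl⟩ := Nat.exists_eq_add_of_lt hij
  refine ⟨d, ?_⟩
  have hi := hfix i
  rw [heq, show i + d + 1 = (d + 1) + i by omega, Function.iterate_add_apply, hfix i] at hi
  exact hi

/-- A nonzero left multiple `z` of a minimal idempotent `f` generates the same left ideal. -/
theorem MinIdem.exists_eq_mul {S : Type*} [SemigroupWithZero S] [Finite S] {f z : S}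
    (hf : MinIdem f) (hz : z * f = z) (hz0 : z ≠ 0) : ∃ u, f = u * z := by
  obtain ⟨hff, -, hmin⟩ := hf
  have hsub : pId z ⊆ pId f := by
    rintro x (rfl | (⟨u, rfl⟩ | ⟨v, rfl⟩) | ⟨u, v, rfl⟩)
    · exact Or.inr (Or.inl (Or.inl ⟨x, hz.symm⟩))
    · exact Or.inr (Or.inl (Or.inl ⟨u * z, by rw [mul_assoc, hz]⟩))
    · exact Or.inr (Or.inr ⟨z, v, by rw [hz]⟩)
    · exact Or.inr (Or.inr ⟨u * z, v, by rw [mul_assoc u z f, hz]⟩)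
  have hmem : f ∈ pId z := (hmin z hsub).resolve_left hz0 ▸ Or.inl rfl
  obtain ⟨u, v, huv⟩ : ∃ u v, f = u * z * v := by
    rcases hmem with h | (⟨u, h⟩ | ⟨v, h⟩) | h
    · exact ⟨f, f, by rw [← h, hff, hff]⟩
    · exact ⟨u, f, by rw [← h, hff]⟩
    · exact ⟨f, v, by rw [mul_assoc, ← h, hff]⟩
    · exact h
  have hw : f = u * z * f * v := by rw [mul_assoc u z f, hz, ← huv]
  obtain ⟨n, hn⟩ := exists_iterate_mul_left_eq_self hw
  have hiter (n : ℕ) : ∃ u', (u * z * ·)^[n] (u * z) = u' * z := by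
    induction n with
    | zero => exact ⟨u, rfl⟩
    | succ n ih =>
      obtain ⟨u', hu'⟩ := ih
      exact ⟨u * z * u', by rw [Function.iterate_succ_apply', hu', mul_assoc (u * z)]⟩
  rw [Function.iterate_succ_apply, mul_assoc u, hz] at hn
  exact (hiter n).imp fun u' hu' => hn.symm.trans hu'

/-- Nonzero products `e * x * f` and `f * y * g` compose to a nonzero `e * (x * y) * g`
when `f` is a minimal idempotent of `M`. -/
theorem mul_mul_ne_zero_of_condIII {S : Type*} [SemigroupWithZero S] [Finite S] {M : Set S}
    (h3 : CondIII M) {e f g x y : S} (he : e ∈ M) (hf : f ∈ M) (hg : g ∈ M)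
    (hmin : MinIdem f) (hx : e * x * f ≠ 0) (hy : f * y * g ≠ 0) :
    e * (x * y) * g ≠ 0 := by
  obtain ⟨u, hu⟩ := hmin.exists_eq_mul (by rw [mul_assoc (e * x), hmin.1]) hx
  have hne : e * x * f * y * g ≠ 0 := fun h0 => hy <| by
    calc f * y * g = u * (e * x * f * y * g) := by
          conv_lhs => rw [hu]
          simp only [mul_assoc]
      _ = 0 := by rw [h0, mul_zero]
  rw [← mul_assoc, ← ((h3 x y e he g hg).1 f hf).resolve_left hne]
  exact hne

/-- A nilpotent subset contains no `x` with `e * x * e ≠ 0`, for a minimal idempotent `e`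
of `M`. -/
theorem not_rhoRel_self {S : Type*} [SemigroupWithZero S] [Finite S] {M T : Set S}
    (h3 : CondIII M) {e : S} (he : e ∈ M) (hmin : MinIdem e) {k : ℕ} (hk : 1 ≤ k)
    (hT : ProdZero T k) : ¬ rhoRel T e e := by
  rintro ⟨x, hxT, hx⟩
  have hpow (n : ℕ) : e * prodl x (List.replicate n x) * e ≠ 0 := by
    induction n with
    | zero => exact hx
    | succ n ih =>
      rw [List.replicate_succ', prodl, List.foldl_append]
      exact mul_mul_ne_zero_of_condIII h3 he he he hmin ih hx
  refine hpow (k - 1) ?_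
  rw [hT x _ hxT (fun y hy => List.eq_of_mem_replicate hy ▸ hxT)
    (by rw [List.length_replicate]; omega), mul_zero, zero_mul]

/-- Let `S` be a finite semigroup with zero with
`R(S) = {0}` and `M` a nonempty set of minimal idempotents satisfying
(I)–(III). For every nilpotent subsemigroup `T` of `S` the relation `ρ_T` is
a strict partial order on `M`: it is transitive, no pair is related in both
directions (in particular `ρ_T` is irreflexive on `M`); moreover `T₁ ⊆ T₂`
implies `ρ_{T₁} ⊆ ρ_{T₂}`. -/
theorem statement17 {S : Type*} [SemigroupWithZero S] [Finite S]
    (hrad : radical S = {0}) (M : Set S) (hMne : M.Nonempty)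
    (hMmin : ∀ e ∈ M, MinIdem e)
    (h1 : CondI M) (h2 : CondII M) (h3 : CondIII M) :
    (∀ T : Set S, IsNilpSubsgp T →
      (∀ e ∈ M, ∀ f ∈ M, ∀ g ∈ M, rhoRel T e f → rhoRel T f g → rhoRel T e g) ∧
      (∀ e ∈ M, ∀ f ∈ M, ¬ (rhoRel T e f ∧ rhoRel T f e)) ∧
      (∀ e ∈ M, ¬ rhoRel T e e)) ∧
    (∀ T₁ T₂ : Set S, IsNilpSubsgp T₁ → IsNilpSubsgp T₂ → T₁ ⊆ T₂ →
      ∀ e ∈ M, ∀ f ∈ M, rhoRel T₁ e f → rhoRel T₂ e f) := by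
  refine ⟨fun T ⟨hsub, k, hk, hT⟩ => ?_,
    fun T₁ T₂ _ _ hsub e _ f _ ⟨x, hx, hne⟩ => ⟨x, hsub hx, hne⟩⟩
  have htrans : ∀ e ∈ M, ∀ f ∈ M, ∀ g ∈ M, rhoRel T e f → rhoRel T f g → rhoRel T e g := by
    rintro e he f hf g hg ⟨x, hx, hxne⟩ ⟨y, hy, hyne⟩
    exact ⟨x * y, hsub hx hy,
      mul_mul_ne_zero_of_condIII h3 he hf hg (hMmin f hf) hxne hyne⟩
  have hirrefl : ∀ e ∈ M, ¬ rhoRel T e e := fun e he =>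
    not_rhoRel_self h3 he (hMmin e he) hk hT
  exact ⟨htrans, fun e he f hf ⟨hef, hfe⟩ => hirrefl e he (htrans e he f hf e he hef hfe),
    hirrefl⟩
end

section
/- Let B_n be the semigroup of all binary relations on the set {1, …, n} under relational composition (α∘β = {(i, j) : there exists k with (i, k) ∈ α and (k, j) ∈ β}), whose zero element is the empty relation. Then B_n contains exactly n! maximal nilpotent subsemigroups; each of them has nilpotency class n and consists of exactly 2^{n(n-1)/2} elements. Moreover, for any two maximal nilpotent subsemigroups T₁, T₂ of B_n there exists a permutation π of {1, …, n} such that T₂ = π⁻¹T₁π (where a permutation is identified with its graph as a binary relation); in particular all maximal nilpotent subsemigroups of B_n are isomorphic. -/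
/-- A binary relation on `{1, …, n}`, viewed as a set of pairs. -/
abbrev BRel (n : ℕ) := Set (Fin n × Fin n)

/-- Relational composition:
`α ∘ β = {(i, j) : ∃ k, (i, k) ∈ α ∧ (k, j) ∈ β}`. -/
def bcomp {n : ℕ} (α β : BRel n) : BRel n :=
  {p | ∃ k, (p.1, k) ∈ α ∧ (k, p.2) ∈ β}

theorem bcomp_assoc {n : ℕ} (α β γ : BRel n) :
    bcomp (bcomp α β) γ = bcomp α (bcomp β γ) := by
  ext p
  constructor
  · rintro ⟨k, ⟨l, h1, h2⟩, h3⟩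
    exact ⟨l, h1, k, h2, h3⟩
  · rintro ⟨k, h1, l, h2, h3⟩
    exact ⟨l, ⟨k, h1, h2⟩, h3⟩

theorem bcomp_empty {n : ℕ} (α : BRel n) : bcomp α ∅ = ∅ := by
  ext p; simp [bcomp]

theorem empty_bcomp {n : ℕ} (α : BRel n) : bcomp ∅ α = ∅ := by
  ext p; simp [bcomp]

/-- The semigroup `B_n` of binary relations on `{1, …, n}` under relational
composition, with the empty relation as zero element. -/
instance BRel.instSemigroupWithZero (n : ℕ) : SemigroupWithZero (BRel n) :=
  { mul := bcomp
    zero := ∅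
    mul_assoc := bcomp_assoc
    zero_mul := empty_bcomp
    mul_zero := bcomp_empty }

theorem BRel.mul_def {n : ℕ} (α β : BRel n) : α * β = bcomp α β := rfl

/-- The graph of a permutation `π` of `{1, …, n}`, as a binary relation. -/
def pgraph {n : ℕ} (π : Equiv.Perm (Fin n)) : BRel n := {p | p.2 = π p.1}

theorem BRel.mem_mul {n : ℕ} {α β : BRel n} {p : Fin n × Fin n} :
    p ∈ α * β ↔ ∃ k, (p.1, k) ∈ α ∧ (k, p.2) ∈ β := Iff.rfl

theorem BRel.notMem_zero {n : ℕ} (p : Fin n × Fin n) : p ∉ (0 : BRel n) :=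
  Set.notMem_empty p

/-- The pairs that are strictly increasing for the linear order transported along `σ`. -/
def orderRel {n : ℕ} (σ : Equiv.Perm (Fin n)) : BRel n := {p | σ p.1 < σ p.2}

/-- The relations contained in the strict linear order transported along `σ`. -/
def triangular {n : ℕ} (σ : Equiv.Perm (Fin n)) : Set (BRel n) := 𝒫 (orderRel σ)

theorem mem_triangular {n : ℕ} {σ : Equiv.Perm (Fin n)} {α : BRel n} :
    α ∈ triangular σ ↔ ∀ i j, (i, j) ∈ α → σ i < σ j :=
  ⟨fun h _ _ hij => h hij, fun h p hp => h p.1 p.2 hp⟩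

theorem isSubsgp_triangular {n : ℕ} (σ : Equiv.Perm (Fin n)) : IsSubsgp (triangular σ) := by
  intro α β hα hβ
  rw [mem_triangular] at *
  rintro i j ⟨k, h1, h2⟩
  exact (hα _ _ h1).trans (hβ _ _ h2)

theorem add_length_le_of_mem_prodl {n : ℕ} {σ : Equiv.Perm (Fin n)} (l : List (BRel n))
    (hl : ∀ x ∈ l, x ∈ triangular σ) (a : BRel n) (c : ℕ)
    (ha : ∀ i j, (i, j) ∈ a → (σ i : ℕ) + c ≤ σ j) (i j : Fin n) (hij : (i, j) ∈ prodl a l) :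
    (σ i : ℕ) + c + l.length ≤ σ j := by
  induction l generalizing a c with
  | nil => simpa using ha i j hij
  | cons b l ih =>
    have hb := mem_triangular.1 (hl b (by simp))
    have := ih (fun x hx => hl x (by simp [hx])) (a * b) (c + 1) ?_ hij
    · simp only [List.length_cons]
      lia
    · rintro u v ⟨k, h1, h2⟩
      have h3 := ha _ _ h1
      have h4 : (σ k : ℕ) < σ v := hb _ _ h2
      lia

theorem prodZero_triangular {n : ℕ} (σ : Equiv.Perm (Fin n)) : ProdZero (triangular σ) n := by
  intro a l ha hl hlen
  refine Set.eq_empty_of_forall_notMem ?_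
  rintro ⟨i, j⟩ hij
  have := add_length_le_of_mem_prodl l hl a 1
    (fun u v h => Nat.succ_le_of_lt (mem_triangular.1 ha u v h)) i j hij
  have := (σ j).isLt
  lia

theorem mem_prodl_replicate_orderRel {n : ℕ} (σ : Equiv.Perm (Fin n)) (k : ℕ) (a : BRel n)
    (u : Fin n) (c : ℕ) (hc : c + k < n)
    (ha : (u, σ.symm ⟨c, by lia⟩) ∈ a) :
    (u, σ.symm ⟨c + k, hc⟩) ∈ prodl a (List.replicate k (orderRel σ)) := by
  induction k generalizing a c with
  | zero => simpa [prodl] using ha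
  | succ k ih =>
    have := ih (a * orderRel σ) (c + 1) (by lia) ⟨σ.symm ⟨c, by lia⟩, ha, by simp [orderRel]⟩
    simp only [Nat.add_right_comm c 1 k] at this
    exact this

theorem nilpClass_triangular {n : ℕ} (hn : 1 ≤ n) (σ : Equiv.Perm (Fin n)) :
    NilpClass (triangular σ) n := by
  refine ⟨hn, prodZero_triangular σ, fun m hm hz => ?_⟩
  by_contra! hmn
  have hself : orderRel σ ∈ triangular σ := Set.Subset.rfl
  have h0 := hz (orderRel σ) (List.replicate (m - 1) (orderRel σ)) hself
    (fun x hx => (List.eq_of_mem_replicate hx) ▸ hself) (by simp; lia)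
  have := mem_prodl_replicate_orderRel σ (m - 1) (orderRel σ) (σ.symm ⟨0, by lia⟩) 1
    (by lia) (by simp [orderRel])
  rw [h0] at this
  exact BRel.notMem_zero _ this

theorem isNilpSubsgp_triangular {n : ℕ} (hn : 1 ≤ n) (σ : Equiv.Perm (Fin n)) :
    IsNilpSubsgp (triangular σ) :=
  ⟨isSubsgp_triangular σ, n, hn, prodZero_triangular σ⟩

theorem diag_mem_prodl {n : ℕ} {i : Fin n} (l : List (BRel n)) (hl : ∀ x ∈ l, (i, i) ∈ x)
    (a : BRel n) (ha : (i, i) ∈ a) : (i, i) ∈ prodl a l := by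
  induction l generalizing a with
  | nil => exact ha
  | cons b l ih =>
    exact ih (fun x hx => hl x (by simp [hx])) (a * b) ⟨i, ha, hl b (by simp)⟩

theorem diag_notMem_of_isNilpSubsgp {n : ℕ} {T : Set (BRel n)} (hT : IsNilpSubsgp T)
    {α : BRel n} (hα : α ∈ T) (i : Fin n) : (i, i) ∉ α := by
  intro hi
  obtain ⟨k, hk, hz⟩ := hT.2
  have h0 := hz α (List.replicate (k - 1) α) hα
    (fun x hx => (List.eq_of_mem_replicate hx) ▸ hα) (by simp; lia)
  have := diag_mem_prodl (List.replicate (k - 1) α)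
    (fun x hx => (List.eq_of_mem_replicate hx) ▸ hi) α hi
  rw [h0] at this
  exact BRel.notMem_zero _ this

theorem exists_equiv_fin_strictMono {ι : Type*} [Fintype ι] {n : ℕ} (hn : Fintype.card ι = n)
    (r : ι → ι → Prop) (hirr : ∀ i, ¬ r i i) (htrans : ∀ i j k, r i j → r j k → r i k) :
    ∃ σ : ι ≃ Fin n, ∀ i j, r i j → σ i < σ j := by
  have : IsStrictOrder ι r := { irrefl := hirr, trans := htrans }
  let P : PartialOrder ι := partialOrderOfSO r
  have : Fintype (LinearExtension ι) := inferInstanceAs (Fintype ι)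
  let e : Fin n ≃o LinearExtension ι := Fintype.orderIsoFinOfCardEq _ (by
    rw [← hn]; exact Fintype.card_congr (Equiv.refl ι))
  refine ⟨(e.symm.toEquiv : ι ≃ Fin n), fun i j hij => ?_⟩
  have hle : toLinearExtension i ≤ toLinearExtension j :=
    toLinearExtension.monotone (le_of_lt (show i < j from hij))
  have hne : toLinearExtension i ≠ toLinearExtension j := by
    intro h
    have : i = j := h
    exact hirr j (this ▸ hij)
  exact e.symm.strictMono (lt_of_le_of_ne hle hne)

theorem exists_subset_triangular {n : ℕ} {T : Set (BRel n)} (hT : IsNilpSubsgp T) :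
    ∃ σ, T ⊆ triangular σ := by
  obtain ⟨σ, hσ⟩ := exists_equiv_fin_strictMono (Fintype.card_fin n) (fun i j => ∃ α ∈ T, (i, j) ∈ α)
    (fun i ⟨α, hα, hi⟩ => diag_notMem_of_isNilpSubsgp hT hα i hi)
    (fun i j k ⟨α, hα, h1⟩ ⟨β, hβ, h2⟩ => ⟨α * β, hT.1 hα hβ, j, h1, h2⟩)
  exact ⟨σ, fun α hα => mem_triangular.2 fun i j hij => hσ i j ⟨α, hα, hij⟩⟩

theorem eq_of_triangular_subset {n : ℕ} {σ τ : Equiv.Perm (Fin n)}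
    (h : triangular σ ⊆ triangular τ) : σ = τ := by
  have hlt : ∀ i j, σ i < σ j → τ i < τ j := fun i j hij =>
    h (show orderRel σ ∈ triangular σ from Set.Subset.rfl)
      (show (i, j) ∈ orderRel σ from hij)
  have hmono : StrictMono (σ.symm.trans τ) := fun i j hij => hlt _ _ (by simpa using hij)
  let e : Fin n ≃o Fin n := hmono.orderIsoOfSurjective _ (σ.symm.trans τ).surjective
  have he : e = OrderIso.refl _ := Subsingleton.elim _ _
  ext i
  have := DFunLike.congr_fun he (σ i)
  simpa [e] using congrArg Fin.val this.symm

theorem isMaxNilpSubsgp_iff {n : ℕ} (hn : 1 ≤ n) {T : Set (BRel n)} :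
    IsMaxNilpSubsgp T ↔ ∃ σ, triangular σ = T := by
  constructor
  · rintro ⟨hT, hmax⟩
    obtain ⟨σ, hσ⟩ := exists_subset_triangular hT
    exact ⟨σ, hmax _ (isNilpSubsgp_triangular hn σ) hσ⟩
  · rintro ⟨σ, rfl⟩
    refine ⟨isNilpSubsgp_triangular hn σ, fun T' hT' hsub => ?_⟩
    obtain ⟨τ, hτ⟩ := exists_subset_triangular hT'
    obtain rfl := eq_of_triangular_subset (hsub.trans hτ)
    exact hτ.antisymm hsub

theorem ncard_setOf_isMaxNilpSubsgp {n : ℕ} (hn : 1 ≤ n) :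
    Set.ncard {T : Set (BRel n) | IsMaxNilpSubsgp T} = n.factorial := by
  have : {T : Set (BRel n) | IsMaxNilpSubsgp T} = Set.range triangular :=
    Set.ext fun T => isMaxNilpSubsgp_iff hn
  rw [this, ← Set.image_univ,
    Set.ncard_image_of_injective _ fun σ τ h => eq_of_triangular_subset h.subset,
    Set.ncard_univ, Nat.card_eq_fintype_card, Fintype.card_perm, Fintype.card_fin]

theorem ncard_orderRel {n : ℕ} (σ : Equiv.Perm (Fin n)) :
    (orderRel σ).ncard = n * (n - 1) / 2 := by
  have himage : (Equiv.prodCongr σ σ) '' orderRel σ = {p : Fin n × Fin n | p.1 < p.2} := by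
    ext p
    rw [Equiv.image_eq_preimage_symm]
    simp [orderRel]
  have hfin : {p : Fin n × Fin n | p.1 < p.2} =
      ((Finset.univ.filter fun p : Fin n × Fin n => p.1 < p.2 : Finset _) : Set _) := by
    ext; simp
  rw [← Set.ncard_image_of_injective _ (Equiv.prodCongr σ σ).injective, himage, hfin,
    Set.ncard_coe_finset, Finset.card_filter, Fintype.sum_prod_type_right]
  simp_rw [← Finset.card_filter]
  simp only [Finset.filter_gt_eq_Iio, Fin.card_Iio]
  rw [Fin.sum_univ_eq_sum_range (fun i => i), Finset.sum_range_id]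

theorem ncard_triangular {n : ℕ} (σ : Equiv.Perm (Fin n)) :
    (triangular σ).ncard = 2 ^ (n * (n - 1) / 2) := by
  rw [triangular, Set.ncard_powerset, ncard_orderRel]

/-- Conjugation by a permutation, as a bijection of binary relations. -/
def conjEquiv {n : ℕ} (π : Equiv.Perm (Fin n)) : BRel n ≃ BRel n :=
  Equiv.Set.congr (Equiv.prodCongr π π)

theorem mem_conjEquiv {n : ℕ} (π : Equiv.Perm (Fin n)) (α : BRel n) (p : Fin n × Fin n) :
    p ∈ conjEquiv π α ↔ (π.symm p.1, π.symm p.2) ∈ α := by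
  change p ∈ (Equiv.prodCongr π π) '' α ↔ _
  rw [Equiv.image_eq_preimage_symm]
  rfl

theorem conjEquiv_mul {n : ℕ} (π : Equiv.Perm (Fin n)) (α β : BRel n) :
    conjEquiv π (α * β) = conjEquiv π α * conjEquiv π β := by
  ext p
  simp only [mem_conjEquiv, BRel.mem_mul]
  exact (π.symm.surjective.exists (p := fun k => (π.symm p.1, k) ∈ α ∧ (k, π.symm p.2) ∈ β))

theorem conjEquiv_apply {n : ℕ} (π : Equiv.Perm (Fin n)) (α : BRel n) :
    conjEquiv π α = pgraph π⁻¹ * α * pgraph π := by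
  ext ⟨i, j⟩
  simp only [mem_conjEquiv, BRel.mem_mul, pgraph, Set.mem_ofPred_eq]
  constructor
  · intro h
    exact ⟨π.symm j, ⟨π.symm i, rfl, h⟩, by simp⟩
  · rintro ⟨k, ⟨l, rfl, h⟩, rfl⟩
    simpa using h

theorem conjEquiv_image_triangular {n : ℕ} (σ τ : Equiv.Perm (Fin n)) :
    conjEquiv (σ.trans τ.symm) '' triangular σ = triangular τ := by
  ext β
  obtain ⟨α, rfl⟩ := (conjEquiv (σ.trans τ.symm)).surjective β
  rw [(conjEquiv _).injective.mem_set_image, mem_triangular, mem_triangular]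
  simp only [mem_conjEquiv]
  constructor
  · intro h i j hij
    simpa using h _ _ hij
  · intro h i j hij
    simpa using h (τ.symm (σ i)) (τ.symm (σ j)) (by simpa using hij)

/-- The semigroup `B_n` of binary relations on `{1, …, n}`
contains exactly `n!` maximal nilpotent subsemigroups; each of them has
nilpotency class `n` and consists of exactly `2 ^ (n(n-1)/2)` elements.
Moreover, any two maximal nilpotent subsemigroups `T₁, T₂` of `B_n` are
conjugate: `T₂ = π⁻¹ T₁ π` for some permutation `π` (identified with its
graph); in particular all maximal nilpotent subsemigroups of `B_n` are
isomorphic. -/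
theorem statement19 (n : ℕ) (hn : 1 ≤ n) :
    Set.ncard {T : Set (BRel n) | IsMaxNilpSubsgp T} = Nat.factorial n ∧
    (∀ T : Set (BRel n), IsMaxNilpSubsgp T → NilpClass T n) ∧
    (∀ T : Set (BRel n), IsMaxNilpSubsgp T → T.ncard = 2 ^ (n * (n - 1) / 2)) ∧
    (∀ T₁ T₂ : Set (BRel n), IsMaxNilpSubsgp T₁ → IsMaxNilpSubsgp T₂ →
      ∃ π : Equiv.Perm (Fin n),
        T₂ = (fun α => pgraph π⁻¹ * α * pgraph π) '' T₁) ∧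
    (∀ T₁ T₂ : Set (BRel n), IsMaxNilpSubsgp T₁ → IsMaxNilpSubsgp T₂ →
      ∃ φ : BRel n ≃ BRel n,
        (∀ α β : BRel n, φ (α * β) = φ α * φ β) ∧ φ '' T₁ = T₂) := by
  refine ⟨ncard_setOf_isMaxNilpSubsgp hn, ?_, ?_, ?_, ?_⟩ <;> simp only [isMaxNilpSubsgp_iff hn]
  · rintro _ ⟨σ, rfl⟩
    exact nilpClass_triangular hn σ
  · rintro _ ⟨σ, rfl⟩
    exact ncard_triangular σ
  · rintro _ _ ⟨σ, rfl⟩ ⟨τ, rfl⟩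
    refine ⟨σ.trans τ.symm, ?_⟩
    simp only [← conjEquiv_apply, conjEquiv_image_triangular]
  · rintro _ _ ⟨σ, rfl⟩ ⟨τ, rfl⟩
    exact ⟨conjEquiv (σ.trans τ.symm), conjEquiv_mul _, conjEquiv_image_triangular σ τ⟩
end
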